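/- For every natural number n ≥ 3, the number of sets S of splits of Fin (n+1) such that S has exactly n - 2 elements and the splits in S are pairwise compatible equals (2n - 3)!! (the double factorial). These maximal pairwise compatible split systems correspond exactly to the binary rooted tree topologies with n labeled leaves, so this is the paper's claim that BHV_n is built from (2n-3)!! orthants of maximal dimension. -/

import Mathlib

/-- A split of `Fin m`: a subset `A` with `2 ≤ |A|` and `2 ≤ |Aᶜ|`, representing the
unordered bipartition `{A, Aᶜ}` of the `m` leaves.  As in the counting of bipartitions,
each unordered bipartition `{A, Aᶜ}` is represented once, by its part containing `0`. -/
def IsSplit (m : ℕ) (A : Finset (Fin m)) : Prop :=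
  2 ≤ A.card ∧ 2 ≤ Aᶜ.card

/-- Two splits are compatible if one of the four corner intersections is empty. -/
def SplitCompatible {m : ℕ} (A B : Finset (Fin m)) : Prop :=
  A ∩ B = ∅ ∨ A ∩ Bᶜ = ∅ ∨ Aᶜ ∩ B = ∅ ∨ Aᶜ ∩ Bᶜ = ∅

/-- Hierarchies (laminar families of nonempty subsets of `X`). -/
def Hier {α : Type*} [DecidableEq α] (X : Finset α) (F : Finset (Finset α)) : Prop :=
  (∀ A ∈ F, A.Nonempty ∧ A ⊆ X) ∧ ∀ A ∈ F, ∀ B ∈ F, A ⊆ B ∨ B ⊆ A ∨ ∀ y ∈ A, y ∉ B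

/-- Insert the new leaf `x` on the edge above `C`. -/
def hins {α : Type*} [DecidableEq α] (x : α) (F : Finset (Finset α)) (C : Finset α) :
    Finset (Finset α) :=
  insert {x} (insert C (F.image (fun D => if C ⊆ D then insert x D else D)))

/-- Remove the leaf `x`. -/
def hres {α : Type*} [DecidableEq α] (x : α) (F : Finset (Finset α)) : Finset (Finset α) :=
  (F.image (fun D => D.erase x)).erase ∅

theorem mem_hins {α : Type*} [DecidableEq α] {x : α} {F : Finset (Finset α)} {C D : Finset α} :
    D ∈ hins x F C ↔ D = {x} ∨ D = C ∨ (∃ E ∈ F, C ⊆ E ∧ D = insert x E) ∨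
      (D ∈ F ∧ ¬ C ⊆ D) := by
  simp only [hins, Finset.mem_insert, Finset.mem_image]
  constructor
  · rintro (h | h | ⟨E, hE, h⟩)
    · exact Or.inl h
    · exact Or.inr (Or.inl h)
    · split_ifs at h with hc
      · exact Or.inr (Or.inr (Or.inl ⟨E, hE, hc, h.symm⟩))
      · subst h; exact Or.inr (Or.inr (Or.inr ⟨hE, hc⟩))
  · rintro (h | h | ⟨E, hE, hc, h⟩ | ⟨h, hc⟩)
    · exact Or.inl h
    · exact Or.inr (Or.inl h)
    · exact Or.inr (Or.inr ⟨E, hE, by rw [if_pos hc, h]⟩)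
    · exact Or.inr (Or.inr ⟨D, h, by rw [if_neg hc]⟩)

theorem mem_hres {α : Type*} [DecidableEq α] {x : α} {F : Finset (Finset α)} {D : Finset α} :
    D ∈ hres x F ↔ D.Nonempty ∧ ∃ E ∈ F, E.erase x = D := by
  simp only [hres, Finset.mem_erase, Finset.mem_image, Finset.nonempty_iff_ne_empty]

theorem hier_hres {α : Type*} [DecidableEq α] {x : α} {X : Finset α} {F : Finset (Finset α)}
    (h : Hier (insert x X) F) : Hier X (hres x F) := by
  refine ⟨?_, ?_⟩
  · intro A hA
    obtain ⟨hn, E, hE, rfl⟩ := mem_hres.1 hA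
    refine ⟨hn, ?_⟩
    have := (h.1 E hE).2
    intro y hy
    grind
  · intro A hA B hB
    obtain ⟨-, E, hE, rfl⟩ := mem_hres.1 hA
    obtain ⟨-, G, hG, rfl⟩ := mem_hres.1 hB
    rcases h.2 E hE G hG with h | h | h
    · exact Or.inl (Finset.erase_subset_erase x h)
    · exact Or.inr (Or.inl (Finset.erase_subset_erase x h))
    · right; right; intro y hy; grind

theorem hier_hins {α : Type*} [DecidableEq α] {x : α} {X : Finset α} (hx : x ∉ X)
    {F : Finset (Finset α)} (h : Hier X F) {C : Finset α} (hC : C ∈ F) :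
    Hier (insert x X) (hins x F C) := by
  have hCn := (h.1 C hC).1
  have hCX := (h.1 C hC).2
  refine ⟨?_, ?_⟩
  · intro A hA
    rcases mem_hins.1 hA with rfl | rfl | ⟨E, hE, hc, rfl⟩ | ⟨hA, hc⟩
    · simp
    · exact ⟨hCn, hCX.trans (Finset.subset_insert _ _)⟩
    · exact ⟨by simp, Finset.insert_subset_insert x (h.1 E hE).2⟩
    · exact ⟨(h.1 A hA).1, (h.1 A hA).2.trans (Finset.subset_insert _ _)⟩
  · have key : ∀ E ∈ F, C ⊆ E → ∀ B ∈ F, ¬ C ⊆ B → B ⊆ insert x E ∨ ∀ y ∈ insert x E, y ∉ B := by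
      intro E hE hc B hB hcB
      have hBX := (h.1 B hB).2
      rcases h.2 E hE B hB with h | h | h
      · exact absurd (hc.trans h) hcB
      · exact Or.inl (h.trans (Finset.subset_insert _ _))
      · right; intro y hy; grind
    intro A hA B hB
    rcases mem_hins.1 hA with rfl | rfl | ⟨E, hE, hc, rfl⟩ | ⟨hA, hc⟩ <;>
    rcases mem_hins.1 hB with rfl | rfl | ⟨G, hG, hd, rfl⟩ | ⟨hB, hd⟩
    · simp
    · right; right; grind
    · left; simp
    · have := (h.1 B hB).2
      right; right; grind
    · right; right; grind
    · simp
    · left; exact hd.trans (Finset.subset_insert _ _)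
    · exact h.2 _ hC _ hB
    · right; left; simp
    · right; left; exact hc.trans (Finset.subset_insert _ _)
    · rcases h.2 E hE G hG with h | h | h
      · exact Or.inl (Finset.insert_subset_insert x h)
      · exact Or.inr (Or.inl (Finset.insert_subset_insert x h))
      · obtain ⟨c, hcc⟩ := hCn
        exact absurd (hd hcc) (h c (hc hcc))
    · right; exact key E hE hc B hB hd
    · have := (h.1 A hA).2
      right; right; grind
    · exact h.2 _ (by assumption) _ hC
    · rcases key G hG hd A hA hc with h | h
      · exact Or.inl h
      · right; right; intro y hy hy'; exact h y hy' hy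
    · exact h.2 _ hA _ hB

theorem card_hins {α : Type*} [DecidableEq α] {x : α} {X : Finset α} (hx : x ∉ X)
    {F : Finset (Finset α)} (h : Hier X F) {C : Finset α} (hC : C ∈ F) :
    (hins x F C).card = F.card + 2 := by
  have hxF : ∀ A ∈ F, x ∉ A := fun A hA hxA => hx ((h.1 A hA).2 hxA)
  have hnF : ∀ A ∈ F, A ≠ ∅ := fun A hA => (h.1 A hA).1.ne_empty
  unfold hins
  rw [Finset.card_insert_of_notMem, Finset.card_insert_of_notMem, Finset.card_image_of_injOn]
  · intro A hA B hB hAB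
    have h1 := hxF A hA
    have h2 := hxF B hB
    simp only at hAB
    split_ifs at hAB
    · rw [← Finset.erase_insert h1, hAB, Finset.erase_insert h2]
    · grind
    · grind
    · exact hAB
  · intro hm
    obtain ⟨D, hD, hm⟩ := Finset.mem_image.1 hm
    have := hxF C hC
    split_ifs at hm <;> grind
  · intro hm
    rcases Finset.mem_insert.1 hm with hm | hm
    · have := hxF C hC
      grind
    obtain ⟨D, hD, hm⟩ := Finset.mem_image.1 hm
    have h1 := hxF D hD
    obtain ⟨y, hy⟩ := (h.1 D hD).1
    split_ifs at hm
    · have : y ∈ insert x D := by simp [hy]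
      rw [hm] at this
      grind
    · grind

theorem hres_hins {α : Type*} [DecidableEq α] {x : α} {X : Finset α} (hx : x ∉ X)
    {F : Finset (Finset α)} (h : Hier X F) {C : Finset α} (hC : C ∈ F) :
    hres x (hins x F C) = F := by
  have hxF : ∀ A ∈ F, x ∉ A := fun A hA hxA => hx ((h.1 A hA).2 hxA)
  ext D
  rw [mem_hres]
  constructor
  · rintro ⟨hn, E, hE, rfl⟩
    rcases mem_hins.1 hE with rfl | rfl | ⟨G, hG, hc, rfl⟩ | ⟨hA, hc⟩
    · simp at hn
    · rwa [Finset.erase_eq_of_notMem (hxF _ hC)]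
    · rwa [Finset.erase_insert (hxF _ hG)]
    · rwa [Finset.erase_eq_of_notMem (hxF _ hA)]
  · intro hD
    refine ⟨(h.1 D hD).1, ?_⟩
    by_cases hc : C ⊆ D
    · exact ⟨insert x D, mem_hins.2 (Or.inr (Or.inr (Or.inl ⟨D, hD, hc, rfl⟩))),
        Finset.erase_insert (hxF _ hD)⟩
    · exact ⟨D, mem_hins.2 (Or.inr (Or.inr (Or.inr ⟨hD, hc⟩))),
        Finset.erase_eq_of_notMem (hxF _ hD)⟩

theorem doubled_unique {α : Type*} [DecidableEq α] {x : α} {X : Finset α}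
    {F : Finset (Finset α)} (h : Hier X F) {C D : Finset α} (hC : C ∈ F) (hD : D ∈ F)
    (hxC : x ∉ C) (hxD : x ∉ D) (hC' : insert x C ∈ F) (hD' : insert x D ∈ F) : C = D := by
  have aux : ∀ {C D : Finset α}, C ∈ F → D ∈ F → x ∉ C → x ∉ D → insert x C ∈ F →
      insert x D ∈ F → C ⊆ D → C = D := by
    intro C D hC hD hxC hxD hC' hD' hCD
    obtain ⟨c, hc⟩ := (h.1 C hC).1
    rcases h.2 _ hC' _ hD with h | h | h
    · exact absurd (h (Finset.mem_insert_self x C)) hxD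
    · apply hCD.antisymm
      intro y hy
      have := h hy
      grind
    · exact absurd (hCD hc) (h c (by simp [hc]))
  rcases h.2 _ hC' _ hD' with h | h | h
  · refine aux hC hD hxC hxD hC' hD' ?_
    intro y hy
    have := h (Finset.mem_insert_of_mem hy)
    grind
  · refine (aux hD hC hxD hxC hD' hC' ?_).symm
    intro y hy
    have := h (Finset.mem_insert_of_mem hy)
    grind
  · exact absurd (Finset.mem_insert_self x D) (h x (Finset.mem_insert_self x C))

theorem hier_subset_hins {α : Type*} [DecidableEq α] {x : α} {X : Finset α}
    {F : Finset (Finset α)} (h : Hier X F) {C : Finset α} (hC : C ∈ F)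
    (hxC : x ∉ C) (hC' : insert x C ∈ F) : F ⊆ hins x (hres x F) C := by
  intro D hD
  rw [mem_hins]
  obtain ⟨c, hc⟩ := (h.1 C hC).1
  obtain ⟨d, hd⟩ := (h.1 D hD).1
  by_cases hxD : x ∈ D
  · by_cases h1 : D = {x}
    · exact Or.inl h1
    right; right; left
    have hne : (D.erase x).Nonempty := by
      rw [Finset.nonempty_iff_ne_empty]
      intro h2
      rw [Finset.erase_eq_empty_iff] at h2
      grind
    refine ⟨D.erase x, mem_hres.2 ⟨hne, D, hD, rfl⟩, ?_, (Finset.insert_erase hxD).symm⟩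
    have hCD : C ⊆ D := by
      rcases h.2 _ hC' _ hD with h2 | h2 | h2
      · exact (Finset.subset_insert _ _).trans h2
      · rcases h.2 _ hC _ hD with h3 | h3 | h3
        · exact h3
        · exact absurd (h3 hxD) hxC
        · obtain ⟨y, hy⟩ := hne
          have := h2 (Finset.mem_of_mem_erase hy)
          grind
      · exact absurd hxD (h2 x (Finset.mem_insert_self _ _))
    intro y hy
    have := hCD hy
    grind
  · by_cases h1 : D = C
    · exact Or.inr (Or.inl h1)
    right; right; right
    refine ⟨mem_hres.2 ⟨⟨d, hd⟩, D, hD, Finset.erase_eq_of_notMem hxD⟩, ?_⟩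
    intro hCD
    rcases h.2 _ hC' _ hD with h2 | h2 | h2
    · exact hxD (h2 (Finset.mem_insert_self _ _))
    · apply h1
      apply Finset.Subset.antisymm _ hCD
      intro y hy
      have := h2 hy
      grind
    · exact h2 c (by simp [hc]) (hCD hc)

theorem card_hres {α : Type*} [DecidableEq α] {x : α} {X : Finset α}
    {F : Finset (Finset α)} (h : Hier X F) :
    F.card ≤ (hres x F).card + 2 ∧ (F.card = (hres x F).card + 2 →
      ∃ C ∈ F, x ∉ C ∧ insert x C ∈ F) := by
  set P := F.filter (fun D => x ∉ D) with hP
  set Q := (F.filter (fun D => x ∈ D)).erase {x} with hQ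
  set R := Q.image (fun D => D.erase x) with hR
  have hRc : R.card = Q.card := by
    apply Finset.card_image_of_injOn
    intro A hA B hB hAB
    have h1 : x ∈ A := by
      have hA' := Finset.mem_erase.1 (Finset.mem_coe.1 hA)
      exact (Finset.mem_filter.1 hA'.2).2
    have h2 : x ∈ B := by
      have hB' := Finset.mem_erase.1 (Finset.mem_coe.1 hB)
      exact (Finset.mem_filter.1 hB'.2).2
    simp only at hAB
    rw [← Finset.insert_erase h1, hAB, Finset.insert_erase h2]
  have hF : F.card ≤ P.card + Q.card + 1 := by
    have h1 := Finset.card_filter_add_card_filter_not (s := F) (fun D => x ∈ D)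
    have h2 : (F.filter (fun D => x ∈ D)).card ≤ Q.card + 1 := by
      have := Finset.pred_card_le_card_erase (s := F.filter (fun D => x ∈ D)) (a := {x})
      rw [← hQ] at this
      omega
    rw [← hP] at h1
    omega
  have hmem : ∀ C, C ∈ P ∩ R → C ∈ F ∧ x ∉ C ∧ insert x C ∈ F := by
    intro C hC
    simp only [hP, hR, hQ, Finset.mem_inter, Finset.mem_filter, Finset.mem_image,
      Finset.mem_erase] at hC
    obtain ⟨⟨h1, h2⟩, D, ⟨h3, h4, h5⟩, h6⟩ := hC
    refine ⟨h1, h2, ?_⟩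
    rw [← h6, Finset.insert_erase h5]
    exact h4
  have hI : (P ∩ R).card ≤ 1 := by
    rw [Finset.card_le_one]
    intro A hA B hB
    obtain ⟨a1, a2, a3⟩ := hmem A hA
    obtain ⟨b1, b2, b3⟩ := hmem B hB
    exact doubled_unique h a1 b1 a2 b2 a3 b3
  have hU : P ∪ R ⊆ hres x F := by
    intro D hD
    rw [mem_hres]
    rcases Finset.mem_union.1 hD with hD | hD
    · simp only [hP, Finset.mem_filter] at hD
      exact ⟨(h.1 D hD.1).1, D, hD.1, Finset.erase_eq_of_notMem hD.2⟩
    · simp only [hR, hQ, Finset.mem_filter, Finset.mem_image, Finset.mem_erase] at hD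
      obtain ⟨E, ⟨h3, h4, h5⟩, rfl⟩ := hD
      refine ⟨?_, E, h4, rfl⟩
      rw [Finset.nonempty_iff_ne_empty]
      intro h2
      rw [Finset.erase_eq_empty_iff] at h2
      grind
  have hUc := Finset.card_le_card hU
  have hui := Finset.card_union_add_card_inter P R
  refine ⟨by omega, fun he => ?_⟩
  have : 0 < (P ∩ R).card := by omega
  obtain ⟨C, hC⟩ := Finset.card_pos.1 this
  exact ⟨C, hmem C hC⟩

theorem hier_count {α : Type*} [DecidableEq α] (X : Finset α) (hX : X.Nonempty) :
    (∀ F, Hier X F → F.card + 1 ≤ 2 * X.card) ∧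
    {F : Finset (Finset α) | Hier X F ∧ F.card + 1 = 2 * X.card}.ncard =
      Nat.doubleFactorial (2 * X.card - 3) := by
  classical
  induction hX using Finset.Nonempty.cons_induction with
  | singleton a =>
    have key : ∀ F, Hier {a} F → F ⊆ {{a}} := by
      intro F hF A hA
      obtain ⟨h1, h2⟩ := hF.1 A hA
      rw [Finset.mem_singleton]
      exact (Finset.Nonempty.subset_singleton_iff h1).1 h2
    refine ⟨?_, ?_⟩
    · intro F hF
      have := Finset.card_le_card (key F hF)
      simp at this ⊢
      omega
    · have : {F : Finset (Finset α) | Hier {a} F ∧ F.card + 1 = 2 * ({a} : Finset α).card} =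
          {{{a}}} := by
        ext F
        simp only [Set.mem_ofPred_eq, Set.mem_singleton_iff]
        constructor
        · rintro ⟨h1, h2⟩
          apply Finset.eq_of_subset_of_card_le (key F h1)
          rw [Finset.card_singleton] at h2 ⊢
          omega
        · rintro rfl
          refine ⟨⟨by simp, by simp⟩, by simp⟩
      rw [this]
      simp
  | cons x X hx hX ih =>
    obtain ⟨ih1, ih2⟩ := ih
    have hpos := hX.card_pos
    rw [Finset.cons_eq_insert, Finset.card_insert_of_notMem hx]
    refine ⟨?_, ?_⟩
    · intro F hF
      have h1 := ih1 _ (hier_hres hF)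
      have h2 := (card_hres (x := x) hF).1
      omega
    · have hfin : {F : Finset (Finset α) | Hier X F ∧ F.card + 1 = 2 * X.card}.Finite := by
        apply Set.Finite.subset (Finset.finite_toSet (X.powerset.powerset))
        rintro F ⟨hF, -⟩
        simp only [Finset.coe_powerset, Set.mem_preimage, Set.mem_powerset_iff, Finset.mem_coe,
          Finset.mem_powerset]
        intro A hA
        simpa using (hF.1 A hA).2
      set T := hfin.toFinset with hT
      have hTm : ∀ F, F ∈ T ↔ Hier X F ∧ F.card + 1 = 2 * X.card := by
        intro F; simp [hT]
      rw [Set.ncard_eq_toFinset_card _ hfin] at ih2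
      have himg : {F : Finset (Finset α) | Hier (insert x X) F ∧ F.card + 1 = 2 * (X.card + 1)} =
          ((T.sigma (fun F => F)).image (fun p => hins x p.1 p.2) : Finset (Finset (Finset α))) := by
        ext F
        simp only [Set.mem_ofPred_eq, Finset.coe_image, Set.mem_image, Finset.mem_coe,
          Finset.mem_sigma, hTm]
        constructor
        · rintro ⟨h1, h2⟩
          have h3 := ih1 _ (hier_hres h1)
          obtain ⟨h4, h5⟩ := card_hres (x := x) h1
          obtain ⟨C, hC, hxC, hC'⟩ := h5 (by omega)
          have hCr : C ∈ hres x F :=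
            mem_hres.2 ⟨(h1.1 C hC).1, C, hC, Finset.erase_eq_of_notMem hxC⟩
          refine ⟨⟨hres x F, C⟩, ⟨⟨hier_hres h1, by show (hres x F).card + 1 = _; omega⟩, hCr⟩, ?_⟩
          symm
          apply Finset.eq_of_subset_of_card_le (hier_subset_hins h1 hC hxC hC')
          rw [card_hins hx (hier_hres h1) hCr]
          omega
        · rintro ⟨⟨G, C⟩, ⟨⟨h1, h2⟩, hC⟩, rfl⟩
          refine ⟨hier_hins hx h1 hC, ?_⟩
          rw [card_hins hx h1 hC]
          omega
      rw [himg, Set.ncard_coe_finset, Finset.card_image_of_injOn, Finset.card_sigma,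
        Finset.sum_congr rfl (g := fun _ => 2 * X.card - 1), Finset.sum_const, ih2, smul_eq_mul]
      · obtain ⟨k, hk⟩ : ∃ k, X.card = k + 1 := ⟨X.card - 1, by omega⟩
        rw [hk]
        rcases k with _ | k
        · simp
        · have e1 : 2 * (k + 1 + 1 + 1) - 3 = (2 * k + 1) + 2 := by omega
          have e2 : 2 * (k + 1 + 1) - 3 = 2 * k + 1 := by omega
          have e3 : 2 * (k + 1 + 1) - 1 = 2 * k + 1 + 2 := by omega
          rw [e1, e2, e3, Nat.doubleFactorial_add_two, mul_comm]
      · intro F hF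
        have := ((hTm F).1 hF).2
        omega
      · rintro ⟨G, C⟩ hp ⟨G', C'⟩ hp' he
        simp only [Finset.mem_coe, Finset.mem_sigma, hTm] at hp hp'
        obtain ⟨⟨h1, -⟩, hC⟩ := hp
        obtain ⟨⟨h1', -⟩, hC'⟩ := hp'
        simp only at he
        have hG : G = G' := by
          rw [← hres_hins hx h1 hC, he, hres_hins hx h1' hC']
        subst hG
        have hxF : ∀ A ∈ G, x ∉ A := fun A hA hxA => hx ((h1.1 A hA).2 hxA)
        have hH := hier_hins hx h1 hC
        have m1 : C ∈ hins x G C := mem_hins.2 (Or.inr (Or.inl rfl))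
        have m2 : insert x C ∈ hins x G C :=
          mem_hins.2 (Or.inr (Or.inr (Or.inl ⟨C, hC, subset_rfl, rfl⟩)))
        have m3 : C' ∈ hins x G C := by rw [he]; exact mem_hins.2 (Or.inr (Or.inl rfl))
        have m4 : insert x C' ∈ hins x G C := by
          rw [he]; exact mem_hins.2 (Or.inr (Or.inr (Or.inl ⟨C', hC', subset_rfl, rfl⟩)))
        have := doubled_unique hH m1 m3 (hxF _ hC) (hxF _ hC') m2 m4
        subst this
        rfl

/-- The trivial clusters. -/
def hbase {α : Type*} [DecidableEq α] (X : Finset α) : Finset (Finset α) :=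
  insert X (X.image (fun y => {y}))

theorem mem_hbase {α : Type*} [DecidableEq α] {X D : Finset α} :
    D ∈ hbase X ↔ D = X ∨ ∃ y ∈ X, D = {y} := by
  simp only [hbase, Finset.mem_insert, Finset.mem_image, eq_comm]

theorem card_hbase {α : Type*} [DecidableEq α] {X : Finset α} (h : 2 ≤ X.card) :
    (hbase X).card = X.card + 1 := by
  unfold hbase
  rw [Finset.card_insert_of_notMem, Finset.card_image_of_injective]
  · exact Finset.singleton_injective
  · intro hm
    obtain ⟨y, -, hy⟩ := Finset.mem_image.1 hm
    rw [← hy] at h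
    simp at h

theorem hier_union_hbase {α : Type*} [DecidableEq α] {X : Finset α} (hX : X.Nonempty)
    {F : Finset (Finset α)} (h : Hier X F) : Hier X (F ∪ hbase X) := by
  have hsub : ∀ A ∈ F ∪ hbase X, A.Nonempty ∧ A ⊆ X := by
    intro A hA
    rcases Finset.mem_union.1 hA with hA | hA
    · exact h.1 A hA
    · rcases mem_hbase.1 hA with rfl | ⟨y, hy, rfl⟩
      · exact ⟨hX, subset_rfl⟩
      · simpa using hy
  refine ⟨hsub, ?_⟩
  intro A hA B hB
  have hAX := (hsub A hA).2
  have hBX := (hsub B hB).2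
  rcases Finset.mem_union.1 hA with hA | hA
  · rcases Finset.mem_union.1 hB with hB | hB
    · exact h.2 A hA B hB
    · rcases mem_hbase.1 hB with rfl | ⟨y, hy, rfl⟩
      · exact Or.inl hAX
      · by_cases hyA : y ∈ A
        · right; left; simpa using hyA
        · right; right; grind
  · rcases mem_hbase.1 hA with rfl | ⟨y, hy, rfl⟩
    · exact Or.inr (Or.inl hBX)
    · by_cases hyB : y ∈ B
      · left; simpa using hyB
      · right; right; grind

theorem hbase_subset {α : Type*} [DecidableEq α] {X : Finset α} (hX : X.Nonempty)
    {F : Finset (Finset α)} (h : Hier X F) (hc : F.card + 1 = 2 * X.card) : hbase X ⊆ F := by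
  have h1 := (hier_count X hX).1 _ (hier_union_hbase hX h)
  have h2 : F = F ∪ hbase X :=
    Finset.eq_of_subset_of_card_le Finset.subset_union_left (by omega)
  rw [h2]
  exact Finset.subset_union_right

theorem compat_iff {m : ℕ} {A B : Finset (Fin (m + 1))} (hA : 0 ∈ A) (hB : 0 ∈ B) :
    SplitCompatible A B ↔ (Aᶜ ⊆ Bᶜ ∨ Bᶜ ⊆ Aᶜ ∨ ∀ y ∈ Aᶜ, y ∉ Bᶜ) := by
  unfold SplitCompatible
  constructor
  · rintro (h | h | h | h)
    · have : (0 : Fin (m + 1)) ∈ A ∩ B := by simp [hA, hB]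
      simp [h] at this
    · right; left
      rw [Finset.compl_subset_compl]
      intro y hy
      by_contra hyB
      have : y ∈ A ∩ Bᶜ := by simp [hy, hyB]
      simp [h] at this
    · left
      rw [Finset.compl_subset_compl]
      intro y hy
      by_contra hyB
      have : y ∈ Aᶜ ∩ B := by simp [hy, hyB]
      simp [h] at this
    · right; right
      intro y hy hy'
      have : y ∈ Aᶜ ∩ Bᶜ := Finset.mem_inter.2 ⟨hy, hy'⟩
      simp [h] at this
  · rintro (h | h | h)
    · right; right; left
      rw [Finset.compl_subset_compl] at h
      ext y; have := @h y; simp; tauto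
    · right; left
      rw [Finset.compl_subset_compl] at h
      ext y; have := @h y; simp; tauto
    · right; right; right
      ext y; have := h y; simp at this ⊢; tauto

theorem card_maximal_compatible_split_systems (n : ℕ) (hn : 3 ≤ n) :
    Nat.card {S : Finset (Finset (Fin (n + 1))) |
        S.card = n - 2 ∧ (∀ A ∈ S, (0 : Fin (n + 1)) ∈ A ∧ IsSplit (n + 1) A) ∧
        ∀ A ∈ S, ∀ B ∈ S, SplitCompatible A B} =
      Nat.doubleFactorial (2 * n - 3) := by
  set X : Finset (Fin (n + 1)) := Finset.univ.erase 0 with hXdef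
  have hXc : X.card = n := by simp [hXdef]
  have hX : X.Nonempty := Finset.card_pos.1 (by omega)
  have hcount := (hier_count X hX).2
  rw [hXc] at hcount
  rw [Nat.card_coe_set_eq, ← hcount]
  have hcc : ∀ A : Finset (Fin (n + 1)), A.card + Aᶜ.card = n + 1 := by
    intro A; simpa using Finset.card_add_card_compl A
  have hsubX : ∀ A : Finset (Fin (n + 1)), 0 ∉ A → A ⊆ X := by
    intro A hA y hy
    simp only [hXdef, Finset.mem_erase, Finset.mem_univ, and_true]
    rintro rfl; exact hA hy
  have hX0 : (0 : Fin (n + 1)) ∉ X := by simp [hXdef]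
  have hinj : Function.Injective (fun A : Finset (Fin (n + 1)) => Aᶜ) := compl_injective
  -- disjointness from the trivial clusters
  have hdisj : ∀ S : Finset (Finset (Fin (n + 1))),
      (∀ A ∈ S, (0 : Fin (n + 1)) ∈ A ∧ IsSplit (n + 1) A) →
      Disjoint (S.image (fun A => Aᶜ)) (hbase X) := by
    intro S hS
    rw [Finset.disjoint_left]
    intro D hD hb
    obtain ⟨A, hA, rfl⟩ := Finset.mem_image.1 hD
    obtain ⟨-, h1, h2⟩ := hS A hA
    have h3 := hcc A
    rcases mem_hbase.1 hb with h | ⟨y, -, h⟩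
    · rw [h, hXc] at h3; omega
    · rw [h] at h2; simp at h2
  refine Set.ncard_congr (fun S _ => S.image (fun A => Aᶜ) ∪ hbase X) ?_ ?_ ?_
  · rintro S ⟨h1, h2, h3⟩
    refine ⟨hier_union_hbase hX ⟨?_, ?_⟩, ?_⟩
    · intro D hD
      obtain ⟨A, hA, rfl⟩ := Finset.mem_image.1 hD
      obtain ⟨h0, -, h5⟩ := h2 A hA
      exact ⟨Finset.card_pos.1 (by omega), hsubX _ (by simpa using h0)⟩
    · intro D hD E hE
      obtain ⟨A, hA, rfl⟩ := Finset.mem_image.1 hD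
      obtain ⟨B, hB, rfl⟩ := Finset.mem_image.1 hE
      exact (compat_iff (h2 A hA).1 (h2 B hB).1).1 (h3 A hA B hB)
    · rw [Finset.card_union_of_disjoint (hdisj S h2), Finset.card_image_of_injective _ hinj,
        card_hbase (by omega), h1, hXc]
      omega
  · rintro S S' ⟨-, h2, -⟩ ⟨-, h2', -⟩ he
    apply Finset.image_injective hinj
    have e1 := Finset.union_sdiff_cancel_right (hdisj S h2)
    have e2 := Finset.union_sdiff_cancel_right (hdisj S' h2')
    rw [← e1, ← e2]
    exact congrArg (fun Z => Z \ hbase X) he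
  · rintro F ⟨hF, hFc⟩
    have hb := hbase_subset hX hF (by rw [hXc]; exact hFc)
    have hii : ((F \ hbase X).image (fun A => Aᶜ)).image (fun A => Aᶜ) = F \ hbase X := by
      rw [Finset.image_image]
      ext D; simp
    refine ⟨(F \ hbase X).image (fun A => Aᶜ), ⟨?_, ?_, ?_⟩, ?_⟩
    · rw [Finset.card_image_of_injective _ hinj, Finset.card_sdiff_of_subset hb,
        card_hbase (by omega), hXc]
      omega
    · intro A hA
      obtain ⟨D, hD, rfl⟩ := Finset.mem_image.1 hA
      obtain ⟨hDF, hDb⟩ := Finset.mem_sdiff.1 hD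
      obtain ⟨hDn, hDX⟩ := hF.1 D hDF
      have h3 := hcc D
      have hlt : D.card < n := by
        refine lt_of_lt_of_eq (Finset.card_lt_card ?_) hXc
        refine hDX.ssubset_of_ne ?_
        rintro rfl
        exact hDb (mem_hbase.2 (Or.inl rfl))
      have hgt : D.card ≠ 1 := by
        intro h
        obtain ⟨y, rfl⟩ := Finset.card_eq_one.1 h
        exact hDb (mem_hbase.2 (Or.inr ⟨y, by simpa using hDX, rfl⟩))
      have := hDn.card_pos
      refine ⟨?_, ?_, ?_⟩
      · simp only [Finset.mem_compl]
        exact fun h => hX0 (hDX h)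
      · omega
      · rw [compl_compl]; omega
    · intro A hA B hB
      obtain ⟨D, hD, rfl⟩ := Finset.mem_image.1 hA
      obtain ⟨E, hE, rfl⟩ := Finset.mem_image.1 hB
      have hD := (Finset.mem_sdiff.1 hD).1
      have hE := (Finset.mem_sdiff.1 hE).1
      have hD0 : (0 : Fin (n + 1)) ∈ Dᶜ := Finset.mem_compl.2 fun h => hX0 ((hF.1 D hD).2 h)
      have hE0 : (0 : Fin (n + 1)) ∈ Eᶜ := Finset.mem_compl.2 fun h => hX0 ((hF.1 E hE).2 h)
      refine (compat_iff hD0 hE0).2 ?_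
      rw [compl_compl, compl_compl]
      exact hF.2 D hD E hE
    · rw [hii]
      exact Finset.sdiff_union_of_subset hb
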